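/- Minkowski's inequality for negative interval-valued functions (time scale 𝕋 = ℝ). Let a < b be real numbers, let h : ℝ → ℝ be continuous on [a,b], and let f₁, f₂, g₁, g₂ : ℝ → ℝ be continuous on [a,b] with f₁(s) ≤ f₂(s) < 0 and g₁(s) ≤ g₂(s) < 0 for all s ∈ [a,b]. Let p = 2^n for some natural number n ≥ 1 (so p is an even natural number that is a power of 2). Then for i = 1 and i = 2: (∫ s in a..b, |h s| * (fᵢ s + gᵢ s)^p)^((1:ℝ)/p) ≤ (∫ s in a..b, |h s| * (fᵢ s)^p)^((1:ℝ)/p) + (∫ s in a..b, |h s| * (gᵢ s)^p)^((1:ℝ)/p); these express the interval partial-order inequality (∫ |h|·(f+g)^p)^(1/p) ≤ (∫ |h|·f^p)^(1/p) + (∫ |h|·g^p)^(1/p) for the negative interval-valued functions f = [f₁,f₂] and g = [g₁,g₂]. -/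

import Mathlib

open MeasureTheory in
/-- Continuous functions on a compact interval belong to every `Lᵖ` space there. -/
lemma ContinuousOn.memLp_restrict_Ioc {a b : ℝ} {f : ℝ → ℝ} (hf : ContinuousOn f (Set.Icc a b))
    (p : ENNReal) : MemLp f p (volume.restrict (Set.Ioc a b)) := by
  obtain ⟨C, hC⟩ := isCompact_Icc.exists_bound_of_continuousOn hf
  refine MemLp.of_bound
    ((hf.mono Set.Ioc_subset_Icc_self).aestronglyMeasurable measurableSet_Ioc) C ?_
  filter_upwards [ae_restrict_mem measurableSet_Ioc] with s hs
  exact hC s (Set.Ioc_subset_Icc_self hs)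

open MeasureTheory in
/-- Minkowski's inequality with weight `|h|` and even exponent, for continuous functions on a
compact interval. -/
theorem minkowski_weighted_even {a b : ℝ} (hab : a ≤ b) {h f g : ℝ → ℝ}
    (hh : ContinuousOn h (Set.Icc a b)) (hf : ContinuousOn f (Set.Icc a b))
    (hg : ContinuousOn g (Set.Icc a b)) {p : ℕ} (hp : Even p) (hp0 : p ≠ 0) :
    (∫ s in a..b, |h s| * (f s + g s) ^ p) ^ ((1 : ℝ) / p) ≤
      (∫ s in a..b, |h s| * (f s) ^ p) ^ ((1 : ℝ) / p) +
        (∫ s in a..b, |h s| * (g s) ^ p) ^ ((1 : ℝ) / p) := by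
  have hw : ContinuousOn (fun s => |h s| ^ ((p : ℝ)⁻¹)) (Set.Icc a b) :=
    hh.abs.rpow_const fun s _ => Or.inr (by positivity)
  have key : ∀ u : ℝ → ℝ, ContinuousOn u (Set.Icc a b) →
      lpNorm (fun s => |h s| ^ ((p : ℝ)⁻¹) * u s) p (volume.restrict (Set.Ioc a b)) =
        (∫ s in a..b, |h s| * (u s) ^ p) ^ ((1 : ℝ) / p) := by
    intro u hu
    rw [lpNorm_eq_integral_norm_rpow_toReal (by exact_mod_cast hp0) (by simp)
      ((hw.fun_mul hu).memLp_restrict_Ioc p).1, intervalIntegral.integral_of_le hab]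
    simp only [ENNReal.toReal_natCast, Real.rpow_natCast, one_div, norm_mul, mul_pow,
      Real.norm_eq_abs, hp.pow_abs, Real.rpow_inv_natCast_pow (abs_nonneg _) hp0]
  rw [← key _ (hf.fun_add hg), ← key f hf, ← key g hg]
  convert lpNorm_add_le (g := fun s => |h s| ^ ((p : ℝ)⁻¹) * g s)
    ((hw.fun_mul hf).memLp_restrict_Ioc p) (by exact_mod_cast Nat.one_le_iff_ne_zero.2 hp0) using 2
  ext s
  simp [mul_add]


theorem interval_minkowski_neg (a b : ℝ) (hab : a < b) (h f₁ f₂ g₁ g₂ : ℝ → ℝ)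
    (hh : ContinuousOn h (Set.Icc a b))
    (hf₁ : ContinuousOn f₁ (Set.Icc a b)) (hf₂ : ContinuousOn f₂ (Set.Icc a b))
    (hg₁ : ContinuousOn g₁ (Set.Icc a b)) (hg₂ : ContinuousOn g₂ (Set.Icc a b))
    (hfle : ∀ s ∈ Set.Icc a b, f₁ s ≤ f₂ s) (hfneg : ∀ s ∈ Set.Icc a b, f₂ s < 0)
    (hgle : ∀ s ∈ Set.Icc a b, g₁ s ≤ g₂ s) (hgneg : ∀ s ∈ Set.Icc a b, g₂ s < 0)
    (p n : ℕ) (hn : 1 ≤ n) (hpn : p = 2 ^ n) :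
    (∫ s in a..b, |h s| * (f₁ s + g₁ s) ^ p) ^ ((1 : ℝ) / p) ≤
        (∫ s in a..b, |h s| * (f₁ s) ^ p) ^ ((1 : ℝ) / p) +
          (∫ s in a..b, |h s| * (g₁ s) ^ p) ^ ((1 : ℝ) / p) ∧
      (∫ s in a..b, |h s| * (f₂ s + g₂ s) ^ p) ^ ((1 : ℝ) / p) ≤
        (∫ s in a..b, |h s| * (f₂ s) ^ p) ^ ((1 : ℝ) / p) +
          (∫ s in a..b, |h s| * (g₂ s) ^ p) ^ ((1 : ℝ) / p) := by
  have hp : Even p := hpn ▸ (even_two.pow_of_ne_zero (by lia))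
  have hp0 : p ≠ 0 := by simp [hpn]
  exact ⟨minkowski_weighted_even hab.le hh hf₁ hg₁ hp hp0,
    minkowski_weighted_even hab.le hh hf₂ hg₂ hp hp0⟩
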